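/- Let R be a commutative ring, C a semidualizing R-module, and 0 → M' → M → M'' → 0 a short exact sequence of R-modules. If two of the three modules M', M, M'' have finite P_C-projective dimension, then so does the third. -/

import Mathlib

open TensorProduct CategoryTheory

noncomputable section

/-- The natural evaluation map `ν_M : C ⊗_R Hom_R(C,M) → M`, `c ⊗ f ↦ f c`. -/
def evalNu (R : Type) [CommRing R] (C : Type) [AddCommGroup C] [Module R C]
    (M : Type) [AddCommGroup M] [Module R M] :
    (C ⊗[R] (C →ₗ[R] M)) →ₗ[R] M :=
  TensorProduct.lift LinearMap.applyₗ

/-- The natural map `μ_M : M → Hom_R(C, C ⊗_R M)`, `m ↦ (c ↦ c ⊗ m)`. -/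
def muMap (R : Type) [CommRing R] (C : Type) [AddCommGroup C] [Module R C]
    (M : Type) [AddCommGroup M] [Module R M] :
    M →ₗ[R] (C →ₗ[R] (C ⊗[R] M)) :=
  (TensorProduct.mk R C M).flip

/-- `Ext^i_R(A,B)`. -/
def extMod (R : Type) [CommRing R] (A : Type) [AddCommGroup A] [Module R A]
    (B : Type) [AddCommGroup B] [Module R B] (i : ℕ) : ModuleCat R :=
  ((Ext R (ModuleCat R) i).obj (Opposite.op (ModuleCat.of R A))).obj (ModuleCat.of R B)

/-- `Tor_i^R(A,B)`. -/
def torMod (R : Type) [CommRing R] (A : Type) [AddCommGroup A] [Module R A]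
    (B : Type) [AddCommGroup B] [Module R B] (i : ℕ) : ModuleCat R :=
  ((Tor (ModuleCat R) i).obj (ModuleCat.of R A)).obj (ModuleCat.of R B)

/-- A semidualizing module: `C` admits a degreewise finite projective resolution,
the homothety map `R → Hom_R(C,C)` is bijective, and `Ext^i_R(C,C) = 0` for `i ≥ 1`. -/
def IsSemidualizing (R : Type) [CommRing R] (C : Type) [AddCommGroup C] [Module R C] :
    Prop :=
  (∃ (P : ℕ → ModuleCat.{0} R) (d : ∀ n, ↥(P (n + 1)) →ₗ[R] ↥(P n)) (ε : ↥(P 0) →ₗ[R] C),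
      (∀ n, Module.Finite R ↥(P n)) ∧ (∀ n, Module.Projective R ↥(P n)) ∧
      Function.Surjective ε ∧ Function.Exact (d 0) ε ∧
      ∀ n, Function.Exact (d (n + 1)) (d n)) ∧
  Function.Bijective (fun r : R => (r • LinearMap.id : C →ₗ[R] C)) ∧
  ∀ i : ℕ, 1 ≤ i → Subsingleton (extMod R C C i)

/-- The Bass class `B_C`. -/
def MemBassClass (R : Type) [CommRing R] (C : Type) [AddCommGroup C] [Module R C]
    (M : Type) [AddCommGroup M] [Module R M] : Prop :=
  (∀ i : ℕ, 1 ≤ i → Subsingleton (extMod R C M i)) ∧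
  (∀ i : ℕ, 1 ≤ i → Subsingleton (torMod R C (C →ₗ[R] M) i)) ∧
  Function.Bijective (evalNu R C M)

/-- The Auslander class `A_C`. -/
def MemAuslanderClass (R : Type) [CommRing R] (C : Type) [AddCommGroup C] [Module R C]
    (M : Type) [AddCommGroup M] [Module R M] : Prop :=
  (∀ i : ℕ, 1 ≤ i → Subsingleton (torMod R C M i)) ∧
  (∀ i : ℕ, 1 ≤ i → Subsingleton (extMod R C (C ⊗[R] M) i)) ∧
  Function.Bijective (muMap R C M)

/-- `X⁺ : ⋯ → C ⊗ P₁ → C ⊗ P₀ → M → 0` is an augmented proper `P_C`-projective resolution: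
each `Pᵢ` is projective, it is a complex, and `Hom_R(C ⊗ Q, X⁺)` is exact for each
projective module `Q`. -/
def IsAugProperRes (R : Type) [CommRing R] (C : Type) [AddCommGroup C] [Module R C]
    (M : Type) [AddCommGroup M] [Module R M] (P : ℕ → ModuleCat.{0} R)
    (d : ∀ n : ℕ, (C ⊗[R] ↥(P (n + 1))) →ₗ[R] (C ⊗[R] ↥(P n)))
    (ε : (C ⊗[R] ↥(P 0)) →ₗ[R] M) : Prop :=
  (∀ n, Module.Projective R ↥(P n)) ∧
  (∀ n, (d n).comp (d (n + 1)) = 0) ∧ (ε.comp (d 0) = 0) ∧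
  ∀ (Q : Type) [AddCommGroup Q] [Module R Q], Module.Projective R Q →
    Function.Surjective (fun g : (C ⊗[R] Q) →ₗ[R] (C ⊗[R] ↥(P 0)) => ε.comp g) ∧
    Function.Exact (fun g : (C ⊗[R] Q) →ₗ[R] (C ⊗[R] ↥(P 1)) => (d 0).comp g)
      (fun g : (C ⊗[R] Q) →ₗ[R] (C ⊗[R] ↥(P 0)) => ε.comp g) ∧
    ∀ n : ℕ, Function.Exact
      (fun g : (C ⊗[R] Q) →ₗ[R] (C ⊗[R] ↥(P (n + 2))) => (d (n + 1)).comp g)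
      (fun g : (C ⊗[R] Q) →ₗ[R] (C ⊗[R] ↥(P (n + 1))) => (d n).comp g)

/-- Exactness of the augmented complex `⋯ → C ⊗ P₁ → C ⊗ P₀ → M → 0`. -/
def ResExact (R : Type) [CommRing R] (C : Type) [AddCommGroup C] [Module R C]
    (M : Type) [AddCommGroup M] [Module R M] (P : ℕ → ModuleCat.{0} R)
    (d : ∀ n : ℕ, (C ⊗[R] ↥(P (n + 1))) →ₗ[R] (C ⊗[R] ↥(P n)))
    (ε : (C ⊗[R] ↥(P 0)) →ₗ[R] M) : Prop :=
  Function.Surjective ε ∧ Function.Exact (d 0) ε ∧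
    ∀ n : ℕ, Function.Exact (d (n + 1)) (d n)

/-- Exactness of the augmented complex in all degrees `< n`
(`C ⊗ Pᵢ` in degree `i`, `M` in degree `-1`). -/
def ResExactLT (R : Type) [CommRing R] (C : Type) [AddCommGroup C] [Module R C]
    (M : Type) [AddCommGroup M] [Module R M] (P : ℕ → ModuleCat.{0} R)
    (d : ∀ n : ℕ, (C ⊗[R] ↥(P (n + 1))) →ₗ[R] (C ⊗[R] ↥(P n)))
    (ε : (C ⊗[R] ↥(P 0)) →ₗ[R] M) (n : ℕ) : Prop :=
  Function.Surjective ε ∧ (0 < n → Function.Exact (d 0) ε) ∧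
    ∀ i : ℕ, i + 1 < n → Function.Exact (d (i + 1)) (d i)


/-- An exact sequence `0 → C ⊗ P_n → ⋯ → C ⊗ P_1 → C ⊗ P_0 → M → 0`
with each `P_i` projective (encoded by an `ℕ`-indexed complex which vanishes
in degrees `> n`). -/
def HasBoundedExactCRes (R : Type) [CommRing R] (C : Type) [AddCommGroup C] [Module R C]
    (M : Type) [AddCommGroup M] [Module R M] (n : ℕ) : Prop :=
  ∃ (P : ℕ → ModuleCat.{0} R)
    (d : ∀ i : ℕ, (C ⊗[R] ↥(P (i + 1))) →ₗ[R] (C ⊗[R] ↥(P i)))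
    (ε : (C ⊗[R] ↥(P 0)) →ₗ[R] M),
      (∀ i, Module.Projective R ↥(P i)) ∧ ResExact R C M P d ε ∧
      ∀ i, n < i → Subsingleton (C ⊗[R] ↥(P i))

/-- `M` has finite `P_C`-projective dimension. -/
def HasFinCPd (R : Type) [CommRing R] (C : Type) [AddCommGroup C] [Module R C]
    (M : Type) [AddCommGroup M] [Module R M] : Prop :=
  ∃ n : ℕ, HasBoundedExactCRes R C M n

/-- `M` has projective dimension at most `n`: there is an exact sequence
`0 → Q_n → ⋯ → Q_0 → M → 0` with each `Q_i` projective. -/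
def HasProjDimLE (R : Type) [CommRing R] (M : Type) [AddCommGroup M] [Module R M]
    (n : ℕ) : Prop :=
  ∃ (Q : ℕ → ModuleCat.{0} R) (d : ∀ i : ℕ, ↥(Q (i + 1)) →ₗ[R] ↥(Q i))
    (ε : ↥(Q 0) →ₗ[R] M),
      (∀ i, Module.Projective R ↥(Q i)) ∧ Function.Surjective ε ∧
      Function.Exact (d 0) ε ∧ (∀ i, Function.Exact (d (i + 1)) (d i)) ∧
      ∀ i, n < i → Subsingleton ↥(Q i)

/-- `M` has injective dimension at most `n`: there is an exact sequence
`0 → M → I⁰ → ⋯ → Iⁿ → 0` with each `I^j` injective. -/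
def HasInjDimLE (R : Type) [CommRing R] (M : Type) [AddCommGroup M] [Module R M]
    (n : ℕ) : Prop :=
  ∃ (I : ℕ → ModuleCat.{0} R) (δ : ∀ j : ℕ, ↥(I j) →ₗ[R] ↥(I (j + 1)))
    (ι : M →ₗ[R] ↥(I 0)),
      (∀ j, Module.Injective R ↥(I j)) ∧ Function.Injective ι ∧
      Function.Exact ι (δ 0) ∧ (∀ j, Function.Exact (δ j) (δ (j + 1))) ∧
      ∀ j, n < j → Subsingleton ↥(I j)

section ExtPart
variable {R : Type} [CommRing R] {C : Type} [AddCommGroup C] [Module R C]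
  (P : ℕ → ModuleCat.{0} R) (d : ∀ n, ↥(P (n + 1)) →ₗ[R] ↥(P n)) (ε : ↥(P 0) →ₗ[R] C)

/-- the chain complex attached to a concrete resolution -/
def resCx (hd : ∀ n, Function.Exact (d (n + 1)) (d n)) : ChainComplex (ModuleCat.{0} R) ℕ :=
  ChainComplex.of P (fun n => ModuleCat.ofHom (d n)) (fun n => by
    ext x
    exact (hd n).apply_apply_eq_zero x)

lemma resCx_d (hd : ∀ n, Function.Exact (d (n + 1)) (d n)) (n : ℕ) :
    (resCx P d hd).d (n + 1) n = ModuleCat.ofHom (d n) :=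
  ChainComplex.of_d P (fun n => ModuleCat.ofHom (d n)) n

lemma resCx_exactAt (hd : ∀ n, Function.Exact (d (n + 1)) (d n)) (n : ℕ) :
    (resCx P d hd).ExactAt (n + 1) := by
  rw [HomologicalComplex.exactAt_iff' _ (n + 1 + 1) (n + 1) n (by simp) (by simp)]
  rw [ShortComplex.moduleCat_exact_iff]
  intro x hx
  change ((resCx P d hd).d (n + 1) n).hom x = 0 at hx
  change ∃ y, ((resCx P d hd).d (n + 1 + 1) (n + 1)).hom y = x
  rw [resCx_d] at hx ⊢
  exact (hd n x).1 hx

/-- the augmentation -/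
def resE (hd : ∀ n, Function.Exact (d (n + 1)) (d n)) :
    (resCx P d hd).X 0 ⟶ ModuleCat.of R C := ModuleCat.ofHom ε

lemma resE_w (h0 : Function.Exact (d 0) ε) (hd : ∀ n, Function.Exact (d (n + 1)) (d n)) :
    (resCx P d hd).d 1 0 ≫ resE P d ε hd = 0 := by
  rw [resCx_d]
  ext x
  exact h0.apply_apply_eq_zero x

/-- the projective resolution attached to a concrete resolution -/
def resPR (hP : ∀ n, Module.Projective R ↥(P n)) (hε : Function.Surjective ε)
    (h0 : Function.Exact (d 0) ε)
    (hd : ∀ n, Function.Exact (d (n + 1)) (d n)) :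
    ProjectiveResolution (ModuleCat.of R C) where
  complex := resCx P d hd
  projective n := by
    have := hP n
    exact (IsProjective.iff_projective (P n)).1 this
  π := (ChainComplex.toSingle₀Equiv _ _).symm ⟨resE P d ε hd, resE_w P d ε h0 hd⟩
  quasiIso := ⟨fun n => by
    cases n
    · rw [ChainComplex.quasiIsoAt₀_iff, ShortComplex.quasiIso_iff_of_zeros']
      · constructor
        · rw [ShortComplex.moduleCat_exact_iff]
          intro x hx
          change (((ChainComplex.toSingle₀Equiv (resCx P d hd) (ModuleCat.of R C)).symm
            ⟨resE P d ε hd, resE_w P d ε h0 hd⟩).f 0).hom x = 0 at hx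
          rw [ChainComplex.toSingle₀Equiv_symm_apply_f_zero] at hx
          change ∃ y, ((resCx P d hd).d (0 + 1) 0).hom y = x
          rw [resCx_d]
          exact (h0 x).1 hx
        · change Epi (((ChainComplex.toSingle₀Equiv (resCx P d hd) (ModuleCat.of R C)).symm
            ⟨resE P d ε hd, resE_w P d ε h0 hd⟩).f 0)
          rw [ChainComplex.toSingle₀Equiv_symm_apply_f_zero]
          exact (ModuleCat.epi_iff_surjective _).2 hε
      all_goals rfl
    · rw [quasiIsoAt_iff_exactAt']
      · apply resCx_exactAt
      · apply ChainComplex.exactAt_succ_single_obj⟩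

/-- vanishing of all higher `Ext(C,M)`, computed with the given resolution -/
def Acyc (M : Type) [AddCommGroup M] [Module R M] : Prop :=
  ∀ n (φ : ↥(P (n + 1)) →ₗ[R] M), φ.comp (d (n + 1)) = 0 → ∃ ψ : ↥(P n) →ₗ[R] M, φ = ψ.comp (d n)

lemma acyc_of_ext (hP : ∀ n, Module.Projective R ↥(P n)) (hε : Function.Surjective ε)
    (h0 : Function.Exact (d 0) ε)
    (hd : ∀ n, Function.Exact (d (n + 1)) (d n))
    (M : Type) [AddCommGroup M] [Module R M]
    (h : ∀ i : ℕ, 1 ≤ i → Subsingleton (extMod R C M i)) : Acyc P d M := by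
  intro n φ hφ
  have h1 := h (n + 1) (by omega)
  have e := (resPR P d ε hP hε h0 hd).isoExt (R := R) (n + 1) (ModuleCat.of R M)
  have hz : Limits.IsZero (((resPR P d ε hP hε h0 hd).complex.linearYonedaObj R
      (ModuleCat.of R M)).homology (n + 1)) := by
    refine Limits.IsZero.of_iso ?_ e.symm
    exact @ModuleCat.isZero_of_subsingleton _ _ _ h1
  rw [← HomologicalComplex.exactAt_iff_isZero_homology,
    HomologicalComplex.exactAt_iff' _ n (n + 1) (n + 1 + 1) (by simp) (by simp),
    ShortComplex.moduleCat_exact_iff] at hz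
  obtain ⟨y, hy⟩ := hz (ModuleCat.ofHom φ : P (n+1) ⟶ ModuleCat.of R M) (by
    change (resCx P d hd).d (n + 1 + 1) (n + 1) ≫ (ModuleCat.ofHom φ : P (n+1) ⟶ ModuleCat.of R M) = 0
    rw [resCx_d]
    ext x
    exact LinearMap.congr_fun hφ x)
  change (resCx P d hd).d (n + 1) n ≫ (y : P n ⟶ ModuleCat.of R M) = _ at hy
  rw [resCx_d] at hy
  refine ⟨ModuleCat.Hom.hom (y : P n ⟶ ModuleCat.of R M), ?_⟩
  ext x
  have := congrArg (fun (k : P (n+1) ⟶ ModuleCat.of R M) => k.hom x) hy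
  exact this.symm
end ExtPart

section Aux
variable {R : Type} [CommRing R]

lemma factor_inj {X L M N : Type} [AddCommGroup X] [Module R X] [AddCommGroup L] [Module R L]
    [AddCommGroup M] [Module R M] [AddCommGroup N] [Module R N]
    (i : L →ₗ[R] M) (p : M →ₗ[R] N) (hi : Function.Injective i) (hip : Function.Exact i p)
    (l : X →ₗ[R] M) (hl : ∀ x, p (l x) = 0) : ∃ l' : X →ₗ[R] L, ∀ x, i (l' x) = l x := by
  refine ⟨(LinearEquiv.ofInjective i hi).symm.toLinearMap.comp
    (l.codRestrict (LinearMap.range i) (fun x => (hip _).1 (hl x))), fun x => ?_⟩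
  have := LinearEquiv.apply_symm_apply (LinearEquiv.ofInjective i hi)
    (l.codRestrict (LinearMap.range i) (fun x => (hip _).1 (hl x)) x)
  exact congrArg Subtype.val this

lemma factor_surj {X L M N : Type} [AddCommGroup X] [Module R X] [AddCommGroup L] [Module R L]
    [AddCommGroup M] [Module R M] [AddCommGroup N] [Module R N]
    (i : L →ₗ[R] M) (p : M →ₗ[R] N) (hp : Function.Surjective p) (hip : Function.Exact i p)
    (l : M →ₗ[R] X) (hl : ∀ x, l (i x) = 0) : ∃ l' : N →ₗ[R] X, ∀ x, l' (p x) = l x := by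
  refine ⟨((LinearMap.ker p).liftQ l ?_).comp
    (p.quotKerEquivOfSurjective hp).symm.toLinearMap, fun x => ?_⟩
  · intro x hx
    obtain ⟨y, rfl⟩ := (hip x).1 hx
    exact hl y
  · have : (p.quotKerEquivOfSurjective hp).symm (p x) = Submodule.Quotient.mk x := by
      rw [LinearEquiv.symm_apply_eq]; rfl
    simp [this]

lemma finite_comp {F C I : Type} [AddCommGroup F] [Module R F] [AddCommGroup C] [Module R C]
    [Module.Finite R F] (h : F →ₗ[R] (I →₀ C)) :
    {i | (Finsupp.lapply i).comp h ≠ 0}.Finite := by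
  classical
  obtain ⟨s, hs⟩ := Module.Finite.fg_top (R := R) (M := F)
  refine Set.Finite.subset (Finset.finite_toSet (s.biUnion fun x => (h x).support)) ?_
  intro i hi
  by_contra hn
  apply hi
  apply LinearMap.ext_on hs
  intro x hx
  by_contra h2
  apply hn
  simp only [Finset.coe_biUnion, Set.mem_iUnion]
  exact ⟨x, hx, by simpa using h2⟩

section acyc
variable {C : Type} [AddCommGroup C] [Module R C]
  {P : ℕ → ModuleCat.{0} R} {d : ∀ n, ↥(P (n + 1)) →ₗ[R] ↥(P n)} {ε : ↥(P 0) →ₗ[R] C}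

lemma acyc_retract {M N : Type} [AddCommGroup M] [Module R M] [AddCommGroup N] [Module R N]
    (i : M →ₗ[R] N) (r : N →ₗ[R] M) (hr : ∀ x, r (i x) = x) (h : Acyc P d N) : Acyc P d M := by
  intro n φ hφ
  obtain ⟨ψ, hψ⟩ := h n (i.comp φ) (by rw [LinearMap.comp_assoc, hφ, LinearMap.comp_zero])
  refine ⟨r.comp ψ, ?_⟩
  rw [LinearMap.comp_assoc, ← hψ]
  ext x
  simp [hr]

lemma acyc_finsupp (I : Type) (hfin : ∀ n, Module.Finite R (P n)) (h : Acyc P d C) :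
    Acyc P d (I →₀ C) := by
  classical
  intro n φ hφ
  have := hfin (n + 1)
  have hT := finite_comp φ
  have hc : ∀ i, ∃ ψ : ↥(P n) →ₗ[R] C, (Finsupp.lapply i).comp φ = ψ.comp (d n) := fun i =>
    h n _ (by rw [LinearMap.comp_assoc, hφ, LinearMap.comp_zero])
  choose ψ hψ using hc
  refine ⟨∑ i ∈ hT.toFinset, (Finsupp.lsingle i).comp (ψ i), ?_⟩
  ext x j
  have hj : φ x j = ψ j (d n x) := LinearMap.congr_fun (hψ j) x
  simp only [LinearMap.comp_apply, LinearMap.sum_apply, Finsupp.lsingle_apply,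
    Finsupp.finsetSum_apply, Finsupp.single_apply, Finset.sum_ite_eq']
  split_ifs with hm
  · exact hj
  · have : (Finsupp.lapply j).comp φ = 0 := by simpa using hm
    exact LinearMap.congr_fun this x

lemma acyc_tensor (Q : Type) [AddCommGroup Q] [Module R Q] [Module.Projective R Q]
    (hfin : ∀ n, Module.Finite R (P n)) (h : Acyc P d C) : Acyc P d (C ⊗[R] Q) := by
  classical
  obtain ⟨s, hs⟩ := Module.projective_def'.1 (inferInstance : Module.Projective R Q)
  let e := TensorProduct.finsuppScalarRight R R C Q
  refine acyc_retract (e.toLinearMap.comp (s.lTensor C))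
    (((Finsupp.linearCombination R id).lTensor C).comp e.symm.toLinearMap) ?_
    (acyc_finsupp Q hfin h)
  intro x
  simp only [LinearMap.comp_apply, LinearEquiv.coe_coe, LinearEquiv.symm_apply_apply]
  rw [← LinearMap.comp_apply, ← LinearMap.lTensor_comp, hs, LinearMap.lTensor_id]
  rfl

lemma acyc_quot {L M N : Type} [AddCommGroup L] [Module R L]
    [AddCommGroup M] [Module R M] [AddCommGroup N] [Module R N]
    (hP : ∀ n, Module.Projective R (P n))
    (hd : ∀ n, Function.Exact (d (n + 1)) (d n))
    (i : L →ₗ[R] M) (p : M →ₗ[R] N) (hi : Function.Injective i) (hip : Function.Exact i p)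
    (hp : Function.Surjective p) (hL : Acyc P d L) (hM : Acyc P d M) : Acyc P d N := by
  intro n φ hφ
  have := hP (n + 1)
  obtain ⟨φ', hφ'⟩ := Module.projective_lifting_property p φ hp
  obtain ⟨l, hl⟩ := factor_inj i p hi hip (φ'.comp (d (n + 1))) (fun x => by
    have h1 := LinearMap.congr_fun hφ' (d (n+1) x)
    have h2 := LinearMap.congr_fun hφ x
    exact h1.trans h2)
  obtain ⟨l', hl'⟩ := hL (n + 1) l (by
    ext x
    apply hi
    rw [LinearMap.comp_apply, hl]
    simp [(hd (n + 1)).apply_apply_eq_zero x])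
  obtain ⟨ψ, hψ⟩ := hM n (φ' - i.comp l') (by
    ext x
    have h1 := hl x
    rw [hl'] at h1
    simp only [LinearMap.comp_apply] at h1
    simp [h1])
  refine ⟨p.comp ψ, ?_⟩
  ext x
  have h1 := congrArg p (LinearMap.congr_fun hψ x)
  have h2 := LinearMap.congr_fun hφ' x
  simp only [LinearMap.comp_apply, LinearMap.sub_apply, map_sub, hip.apply_apply_eq_zero,
    sub_zero] at h1 h2 ⊢
  rw [← h1, h2]

lemma acyc_lift {L M N : Type} [AddCommGroup L] [Module R L]
    [AddCommGroup M] [Module R M] [AddCommGroup N] [Module R N]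
    (hP : ∀ n, Module.Projective R (P n))
    (hε : Function.Surjective ε) (h0 : Function.Exact (d 0) ε)
    (hd : ∀ n, Function.Exact (d (n + 1)) (d n))
    (i : L →ₗ[R] M) (p : M →ₗ[R] N) (hi : Function.Injective i) (hip : Function.Exact i p)
    (hp : Function.Surjective p) (hL : Acyc P d L) (h : C →ₗ[R] N) :
    ∃ h' : C →ₗ[R] M, p.comp h' = h := by
  have := hP 0
  obtain ⟨φ', hφ'⟩ := Module.projective_lifting_property p (h.comp ε) hp
  obtain ⟨l, hl⟩ := factor_inj i p hi hip (φ'.comp (d 0)) (fun x => by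
    have h1 := LinearMap.congr_fun hφ' (d 0 x)
    simp only [LinearMap.comp_apply, h0.apply_apply_eq_zero, map_zero] at h1 ⊢
    exact h1)
  obtain ⟨l', hl'⟩ := hL 0 l (by
    ext x
    apply hi
    rw [LinearMap.comp_apply, hl]
    simp [(hd 0).apply_apply_eq_zero x])
  obtain ⟨k, hk⟩ := factor_surj (d 0) ε hε h0 (φ' - i.comp l') (by
    intro x
    have h1 := hl x
    rw [hl'] at h1
    simp only [LinearMap.comp_apply] at h1
    simp [h1])
  refine ⟨k, ?_⟩
  ext c
  obtain ⟨x, rfl⟩ := hε c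
  have h2 := LinearMap.congr_fun hφ' x
  simp only [LinearMap.comp_apply] at h2
  simp [hk, hip.apply_apply_eq_zero, h2]

lemma acyc_lift_tensor {L M N Q : Type} [AddCommGroup L] [Module R L]
    [AddCommGroup M] [Module R M] [AddCommGroup N] [Module R N]
    [AddCommGroup Q] [Module R Q] [Module.Projective R Q]
    (hP : ∀ n, Module.Projective R (P n))
    (hε : Function.Surjective ε) (h0 : Function.Exact (d 0) ε)
    (hd : ∀ n, Function.Exact (d (n + 1)) (d n))
    (i : L →ₗ[R] M) (p : M →ₗ[R] N) (hi : Function.Injective i) (hip : Function.Exact i p)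
    (hp : Function.Surjective p) (hL : Acyc P d L) (h : C ⊗[R] Q →ₗ[R] N) :
    ∃ h' : C ⊗[R] Q →ₗ[R] M, p.comp h' = h := by
  have hs : Function.Surjective (LinearMap.compRight R p : (C →ₗ[R] M) →ₗ[R] (C →ₗ[R] N)) := by
    intro k
    obtain ⟨k', hk'⟩ := acyc_lift hP hε h0 hd i p hi hip hp hL k
    exact ⟨k', hk'⟩
  obtain ⟨t, ht⟩ := Module.projective_lifting_property _ (TensorProduct.curry h).flip hs
  refine ⟨TensorProduct.lift t.flip, ?_⟩
  apply TensorProduct.ext'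
  intro c q
  have := LinearMap.congr_fun (LinearMap.congr_fun ht q) c
  simpa using this

end acyc

lemma gruson_aux (K : Type) [AddCommGroup K] [Module R K] (n : ℕ) :
    ∀ (C : Type) [AddCommGroup C] [Module R C] (s : Finset C), s.card ≤ n →
      Submodule.span R (s : Set C) = ⊤ → Subsingleton (C ⊗[R] K) →
      Module.annihilator R C • (⊤ : Submodule R K) = ⊤ := by
  classical
  induction n with
  | zero =>
    intro C _ _ s hs hsp _
    have hs0 : s = ∅ := by simpa using hs
    subst hs0
    have hsub : Subsingleton C := by
      rw [← Submodule.subsingleton_iff R, ← subsingleton_iff_bot_eq_top]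
      simpa using hsp
    have : Module.annihilator R C = ⊤ := Module.annihilator_eq_top_iff.2 hsub
    rw [this, Submodule.top_smul]
  | succ n ih =>
    intro C _ _ s hs hsp hsub
    have key : ∀ c ∈ s,
        LinearMap.ker (LinearMap.toSpanSingleton R C c) • (⊤ : Submodule R K) = ⊤ := by
      intro c hc
      set I : Ideal R := LinearMap.ker (LinearMap.toSpanSingleton R C c) with hI
      let S := LinearMap.range (LinearMap.toSpanSingleton R C c)
      have hcS : c ∈ S := ⟨1, by simp⟩
      have ih' := ih (C ⧸ S) ((s.erase c).image S.mkQ)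
        (by
          refine Finset.card_image_le.trans ?_
          rw [Finset.card_erase_of_mem hc]
          omega)
        (by
          rw [eq_top_iff, ← S.range_mkQ, LinearMap.range_eq_map, ← hsp, Submodule.map_span,
            Submodule.span_le]
          rintro _ ⟨x, hx, rfl⟩
          by_cases hxc : x = c
          · subst hxc
            have : S.mkQ x = 0 := by simpa using hcS
            rw [this]; exact Submodule.zero_mem _
          · apply Submodule.subset_span
            simp only [Finset.coe_image]
            exact ⟨x, by simp [hxc]; exact hx, rfl⟩)
        (by
          have := LinearMap.rTensor_surjective K S.mkQ_surjective
          exact this.subsingleton)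
      refine eq_top_iff.2 (ih'.symm.le.trans (Submodule.smul_le.2 ?_))
      intro r hr k _
      have hrS : ∀ x : C, r • x ∈ S := by
        intro x
        have := Module.mem_annihilator.1 hr (S.mkQ x)
        rw [← map_smul] at this
        exact (Submodule.Quotient.mk_eq_zero S).1 this
      let φ : C →ₗ[R] R ⧸ I :=
        (LinearMap.quotKerEquivRange (LinearMap.toSpanSingleton R C c)).symm.toLinearMap.comp
          ((r • LinearMap.id : C →ₗ[R] C).codRestrict S hrS)
      have hφ : φ c = Submodule.Quotient.mk r := by
        simp only [φ, LinearMap.comp_apply, LinearEquiv.coe_coe]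
        rw [LinearEquiv.symm_apply_eq]
        rfl
      let N : Submodule R K := I • ⊤
      let β : (R ⧸ I) →ₗ[R] (K →ₗ[R] K ⧸ N) :=
        Submodule.liftQ I (LinearMap.toSpanSingleton R (K →ₗ[R] K ⧸ N) N.mkQ) (by
          intro a ha
          rw [LinearMap.mem_ker]
          ext y
          simp only [LinearMap.toSpanSingleton_apply, LinearMap.smul_apply, LinearMap.zero_apply]
          rw [← map_smul]
          exact (Submodule.Quotient.mk_eq_zero N).2
            (Submodule.smul_mem_smul ha (Submodule.mem_top (x := y))))
      have hB : TensorProduct.lift (β.comp φ) (c ⊗ₜ k) = 0 := by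
        rw [Subsingleton.elim (c ⊗ₜ[R] k) 0, map_zero]
      rw [TensorProduct.lift.tmul, LinearMap.comp_apply, hφ] at hB
      have hB2 : N.mkQ (r • k) = 0 := by
        rw [map_smul]; exact hB
      exact (Submodule.Quotient.mk_eq_zero N).1 hB2
    have hprod : ∀ t : Finset C, t ⊆ s →
        (∏ c ∈ t, (LinearMap.ker (LinearMap.toSpanSingleton R C c) : Ideal R)) •
          (⊤ : Submodule R K) = ⊤ := by
      intro t
      induction t using Finset.induction_on with
      | empty => intro _; simp
      | insert a t ha iht =>
        intro hts
        rw [Finset.prod_insert ha, Submodule.mul_smul,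
          iht (fun x hx => hts (Finset.mem_insert_of_mem hx)),
          key a (hts (Finset.mem_insert_self _ _))]
    refine eq_top_iff.2 ((hprod s (Finset.Subset.refl _)).symm.le.trans
      (Submodule.smul_mono_left ?_))
    refine Ideal.prod_le_inf.trans ?_
    intro r hr
    rw [Module.mem_annihilator]
    intro x
    have hx : x ∈ Submodule.span R (s : Set C) := by rw [hsp]; trivial
    induction hx using Submodule.span_induction with
    | mem y hy =>
      have := (Submodule.mem_finsetInf.1 hr) y hy
      simpa using this
    | zero => simp
    | add a b _ _ ha hb => rw [smul_add, ha, hb, add_zero]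
    | smul a b _ hb => rw [smul_comm, hb, smul_zero]

lemma gruson {C K : Type} [AddCommGroup C] [Module R C] [Module.Finite R C]
    [AddCommGroup K] [Module R K]
    (hC : Function.Injective (fun r : R => (r • LinearMap.id : C →ₗ[R] C)))
    (h : Subsingleton (C ⊗[R] K)) : Subsingleton K := by
  obtain ⟨s, hs⟩ := Module.Finite.fg_top (R := R) (M := C)
  have h1 := gruson_aux K s.card C s le_rfl hs h
  have h2 : Module.annihilator R C = ⊥ := by
    rw [eq_bot_iff]
    intro r hr
    apply hC
    ext x
    simpa using Module.mem_annihilator.1 hr x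
  rw [h2, Submodule.bot_smul] at h1
  rw [← Submodule.subsingleton_iff R, ← subsingleton_iff_bot_eq_top]
  exact h1

lemma mu_surj {C Q : Type} [AddCommGroup C] [Module R C] [Module.Finite R C]
    [AddCommGroup Q] [Module R Q] [Module.Projective R Q]
    (hC : Function.Surjective (fun r : R => (r • LinearMap.id : C →ₗ[R] C)))
    (h : C →ₗ[R] C ⊗[R] Q) : ∃ q : Q, ∀ c, h c = c ⊗ₜ q := by
  classical
  obtain ⟨s, hs⟩ := Module.projective_def'.1 (inferInstance : Module.Projective R Q)
  let e := TensorProduct.finsuppScalarRight R R C Q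
  let k : C →ₗ[R] (Q →₀ C) := e.toLinearMap.comp ((s.lTensor C).comp h)
  have hT := finite_comp k
  choose r hr using fun i => hC ((Finsupp.lapply i).comp k)
  let q0 : Q →₀ R := ∑ i ∈ hT.toFinset, Finsupp.single i (r i)
  have hk : ∀ c, k c = e (c ⊗ₜ q0) := by
    intro c
    ext j
    have hj : r j • c = k c j := LinearMap.congr_fun (hr j) c
    rw [TensorProduct.finsuppScalarRight_apply_tmul_apply]
    simp only [q0, Finsupp.finsetSum_apply, Finsupp.single_apply, Finset.sum_ite_eq']
    split_ifs with hm
    · exact hj.symm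
    · have : (Finsupp.lapply j).comp k = 0 := by simpa using hm
      rw [zero_smul]
      exact LinearMap.congr_fun this c
  refine ⟨Finsupp.linearCombination R id q0, fun c => ?_⟩
  have h1 : s.lTensor C (h c) = c ⊗ₜ q0 := e.injective (hk c)
  have h2 := congrArg ((Finsupp.linearCombination R id).lTensor C) h1
  rw [← LinearMap.comp_apply, ← LinearMap.lTensor_comp, hs, LinearMap.lTensor_id] at h2
  simpa using h2

end Aux

section Cls

/-- Modules with a finite resolution by modules `C ⊗ P`, defined inductively. -/
inductive GG (R : Type) [CommRing R] (C : Type) [AddCommGroup C] [Module R C] :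
    (M : Type) → [AddCommGroup M] → [Module R M] → Prop
  | zero (M : Type) [AddCommGroup M] [Module R M] (h : Subsingleton M) : GG R C M
  | step (L M P : Type) [AddCommGroup L] [Module R L] [AddCommGroup M] [Module R M]
      [AddCommGroup P] [Module R P] (hP : Module.Projective R P)
      (i : L →ₗ[R] C ⊗[R] P) (p : C ⊗[R] P →ₗ[R] M) (hi : Function.Injective i)
      (hip : Function.Exact i p) (hp : Function.Surjective p) (hL : GG R C L) : GG R C M

variable {R : Type} [CommRing R] {C : Type} [AddCommGroup C] [Module R C]

lemma GG.iso {M N : Type} [AddCommGroup M] [Module R M] [AddCommGroup N] [Module R N]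
    (h : GG R C M) (e : M ≃ₗ[R] N) : GG R C N := by
  cases h with
  | zero _ h => exact GG.zero _ e.symm.injective.subsingleton
  | step L _ P hP i p hi hip hp hL =>
    refine GG.step L N P hP i (e.toLinearMap.comp p) hi ?_ (e.surjective.comp hp) hL
    intro x
    rw [← hip x]
    simp

lemma GG.destruct {M : Type} [AddCommGroup M] [Module R M] (h : GG R C M) :
    ∃ (L P : ModuleCat.{0} R) (i : L →ₗ[R] C ⊗[R] P) (p : C ⊗[R] P →ₗ[R] M),
      Module.Projective R P ∧ Function.Injective i ∧ Function.Exact i p ∧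
      Function.Surjective p ∧ GG R C L := by
  cases h with
  | zero _ h =>
    refine ⟨ModuleCat.of R PUnit, ModuleCat.of R PUnit, 0, 0, inferInstance, ?_, ?_, ?_,
      GG.zero _ inferInstance⟩
    · exact Function.injective_of_subsingleton _
    · intro x
      have : Subsingleton (C ⊗[R] PUnit.{1}) := inferInstance
      exact ⟨fun _ => ⟨0, this.elim _ _⟩, fun _ => rfl⟩
    · intro x
      exact ⟨0, Subsingleton.elim _ _⟩
  | step L _ P hP i p hi hip hp hL =>
    exact ⟨ModuleCat.of R L, ModuleCat.of R P, i, p, hP, hi, hip, hp, hL⟩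

lemma GG.tensor (P : Type) [AddCommGroup P] [Module R P] [hP : Module.Projective R P] :
    GG R C (C ⊗[R] P) := by
  refine GG.step PUnit _ P hP 0 LinearMap.id (Function.injective_of_subsingleton _) ?_
    Function.surjective_id (GG.zero _ inferInstance)
  intro x
  simp [eq_comm]

/-- a step with `C ⊗ P × C ⊗ Q` in place of `C ⊗ P` -/
lemma GG.step_prod {L M P Q : Type} [AddCommGroup L] [Module R L] [AddCommGroup M] [Module R M]
    [AddCommGroup P] [Module R P] [Module.Projective R P]
    [AddCommGroup Q] [Module R Q] [Module.Projective R Q]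
    (i : L →ₗ[R] (C ⊗[R] P) × (C ⊗[R] Q)) (p : (C ⊗[R] P) × (C ⊗[R] Q) →ₗ[R] M)
    (hi : Function.Injective i)
    (hip : Function.Exact i p) (hp : Function.Surjective p) (hL : GG R C L) : GG R C M := by
  let e : C ⊗[R] (P × Q) ≃ₗ[R] (C ⊗[R] P) × (C ⊗[R] Q) := TensorProduct.prodRight R R C P Q
  refine GG.step L M (P × Q) inferInstance (e.symm.toLinearMap.comp i) (p.comp e.toLinearMap)
    (e.symm.injective.comp hi) ?_ (hp.comp e.surjective) hL
  intro x
  have := hip (e x)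
  simp only [LinearMap.comp_apply, LinearEquiv.coe_coe, this, Set.mem_range]
  simp only [LinearEquiv.symm_apply_eq]

/-- lifting property -/
lemma GG.lift (hC : IsSemidualizing R C) {L M N Q : Type} [AddCommGroup L] [Module R L]
    [AddCommGroup M] [Module R M] [AddCommGroup N] [Module R N]
    [AddCommGroup Q] [Module R Q] [Module.Projective R Q]
    (i : L →ₗ[R] M) (p : M →ₗ[R] N) (hi : Function.Injective i) (hip : Function.Exact i p)
    (hp : Function.Surjective p) (hL : GG R C L) (h : C ⊗[R] Q →ₗ[R] N) :
    ∃ h' : C ⊗[R] Q →ₗ[R] M, ∀ x, p (h' x) = h x := by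
  obtain ⟨⟨P, d, ε, hfin, hP, hε, h0, hd⟩, _, hext⟩ := hC
  have hCa : Acyc P d C := acyc_of_ext P d ε hP hε h0 hd C hext
  have hLa : Acyc P d L := by
    clear hi hip i
    induction hL with
    | zero M h =>
      intro n φ _
      exact ⟨0, by ext x; exact Subsingleton.elim _ _⟩
    | step L M P hP' i p hi hip hp hL ih =>
      exact acyc_quot hP hd i p hi hip hp ih (acyc_tensor P hfin hCa)
  obtain ⟨h', hh⟩ := acyc_lift_tensor hP hε h0 hd i p hi hip hp hLa h
  exact ⟨h', fun x => LinearMap.congr_fun hh x⟩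

lemma IsSemidualizing.fin (hC : IsSemidualizing R C) : Module.Finite R C := by
  obtain ⟨⟨P, d, ε, hfin, hP, hε, h0, hd⟩, _, hext⟩ := hC
  have := hfin 0
  exact Module.Finite.of_surjective ε hε

lemma GG.ker_tensor (hC : IsSemidualizing R C) {P Q : Type}
    [AddCommGroup P] [Module R P] [Module.Projective R P]
    [AddCommGroup Q] [Module R Q] [Module.Projective R Q]
    (h : C ⊗[R] P →ₗ[R] C ⊗[R] Q) (hh : Function.Surjective h) :
    GG R C (LinearMap.ker h) := by
  have := hC.fin
  have hmu : Function.Surjective ((TensorProduct.mk R C Q).flip) := by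
    intro k
    obtain ⟨q, hq⟩ := mu_surj hC.2.1.2 k
    exact ⟨q, by ext c; simp [hq]⟩
  obtain ⟨u, hu⟩ := Module.projective_lifting_property _ (TensorProduct.curry h).flip hmu
  have hhu : h = u.lTensor C := by
    apply TensorProduct.ext'
    intro c x
    have := LinearMap.congr_fun (LinearMap.congr_fun hu x) c
    simpa using this.symm
  subst hhu
  have hK : Subsingleton (C ⊗[R] (Q ⧸ LinearMap.range u)) := by
    have hs := LinearMap.lTensor_surjective C (LinearMap.range u).mkQ_surjective
    refine ⟨fun a b => ?_⟩
    have hz : ∀ a : C ⊗[R] (Q ⧸ LinearMap.range u), a = 0 := by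
      intro a
      obtain ⟨y, rfl⟩ := hs a
      obtain ⟨x, rfl⟩ := hh y
      rw [← LinearMap.comp_apply, ← LinearMap.lTensor_comp, LinearMap.range_mkQ_comp]
      simp
    rw [hz a, hz b]
  have hK2 := gruson hC.2.1.1 hK
  have hus : Function.Surjective u := by
    rw [← LinearMap.range_eq_top]
    exact Submodule.Quotient.subsingleton_iff.1 hK2
  obtain ⟨s, hs⟩ := Module.projective_lifting_property u LinearMap.id hus
  have hs' : ∀ y, u (s y) = y := fun y => LinearMap.congr_fun hs y
  let r : P →ₗ[R] LinearMap.ker u := (LinearMap.id - s.comp u).codRestrict _ (fun x => by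
    simp [hs'])
  have hr : r.comp (LinearMap.ker u).subtype = LinearMap.id := by
    ext ⟨x, hx⟩
    have hx' : u x = 0 := hx
    simp [r, hx']
  have : Module.Projective R (LinearMap.ker u) := Module.Projective.of_split _ r hr
  have hinj : Function.Injective ((LinearMap.ker u).subtype.lTensor C) := by
    apply Function.LeftInverse.injective (g := r.lTensor C)
    intro x
    rw [← LinearMap.comp_apply, ← LinearMap.lTensor_comp, hr, LinearMap.lTensor_id]
    rfl
  have hex : Function.Exact ((LinearMap.ker u).subtype.lTensor C) (u.lTensor C) :=
    lTensor_exact C (LinearMap.exact_subtype_ker_map u) hus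
  have hrange : LinearMap.range ((LinearMap.ker u).subtype.lTensor C) =
      LinearMap.ker (u.lTensor C) := (LinearMap.exact_iff.1 hex).symm
  exact (GG.tensor (R := R) (C := C) (LinearMap.ker u)).iso
    ((LinearEquiv.ofInjective _ hinj).trans (LinearEquiv.ofEq _ _ hrange))

lemma GG.ker_tensor_prod (hC : IsSemidualizing R C) {P T Q : Type}
    [AddCommGroup P] [Module R P] [Module.Projective R P]
    [AddCommGroup T] [Module R T] [Module.Projective R T]
    [AddCommGroup Q] [Module R Q] [Module.Projective R Q]
    (h : (C ⊗[R] P) × (C ⊗[R] T) →ₗ[R] C ⊗[R] Q) (hh : Function.Surjective h) :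
    GG R C (LinearMap.ker h) := by
  let e : C ⊗[R] (P × T) ≃ₗ[R] (C ⊗[R] P) × (C ⊗[R] T) := TensorProduct.prodRight R R C P T
  have := GG.ker_tensor hC (h.comp e.toLinearMap) (hh.comp e.surjective)
  refine this.iso (e.submoduleMap _ |>.trans (LinearEquiv.ofEq _ _ ?_))
  ext x
  simp only [Submodule.mem_map, LinearMap.mem_ker]
  constructor
  · rintro ⟨y, hy, rfl⟩
    exact hy
  · intro hx
    exact ⟨e.symm x, by simpa using hx, by simp⟩

/-- closure under extensions -/
lemma GG.ext (hC : IsSemidualizing R C) {M'' : Type} [AddCommGroup M''] [Module R M'']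
    (h'' : GG R C M'') : ∀ {M' M : Type} [AddCommGroup M'] [Module R M']
    [AddCommGroup M] [Module R M] (f : M' →ₗ[R] M) (g : M →ₗ[R] M'')
    (_ : Function.Injective f) (_ : Function.Exact f g)
    (_ : Function.Surjective g) (_ : GG R C M'), GG R C M := by
  induction h'' with
  | zero M'' h =>
    intro M' M _ _ _ _ f g hf hfg hg h'
    refine h'.iso (LinearEquiv.ofBijective f ⟨hf, fun x => (hfg x).1 (Subsingleton.elim _ _)⟩)
  | step L'' M'' Q hQ i'' p'' hi'' hip'' hp'' hL'' ih =>
    intro M' M _ _ _ _ f g hf hfg hg h'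
    obtain ⟨q, hq⟩ := GG.lift hC f g hf hfg hg h' p''
    obtain ⟨L', P, i', p', hP, hi', hip', hp', hL'⟩ := h'.destruct
    let π : (C ⊗[R] P) × (C ⊗[R] Q) →ₗ[R] M := (f.comp p').coprod q
    have hπ : ∀ a b, π (a, b) = f (p' a) + q b := fun a b => by simp [π]
    have hπs : Function.Surjective π := by
      intro m
      obtain ⟨b, hb⟩ := hp'' (g m)
      obtain ⟨m', hm'⟩ := (hfg (m - q b)).1 (by rw [map_sub, hq, hb, sub_self])
      obtain ⟨a, rfl⟩ := hp' m'
      exact ⟨(a, b), by rw [hπ, hm', sub_add_cancel]⟩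
    refine GG.step_prod (LinearMap.ker π).subtype π (Submodule.injective_subtype _)
      (LinearMap.exact_subtype_ker_map π) hπs ?_
    let α : L' →ₗ[R] LinearMap.ker π :=
      ((LinearMap.inl R (C ⊗[R] P) (C ⊗[R] Q)).comp i').codRestrict _ (fun l => by
        simp [hπ, hip'.apply_apply_eq_zero])
    obtain ⟨β, hβ⟩ := factor_inj i'' p'' hi'' hip''
      ((LinearMap.snd R (C ⊗[R] P) (C ⊗[R] Q)).comp (LinearMap.ker π).subtype) (by
        rintro ⟨⟨a, b⟩, hx⟩
        have hx' : f (p' a) + q b = 0 := by rw [← hπ]; exact hx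
        have := congrArg g hx'
        rw [map_add, hfg.apply_apply_eq_zero, zero_add, hq, map_zero] at this
        exact this)
    refine ih α β ?_ ?_ ?_ hL'
    · intro x y hxy
      apply hi'
      exact congrArg (fun z : LinearMap.ker π => z.1.1) hxy
    · rintro ⟨⟨a, b⟩, hx⟩
      have hx' : f (p' a) + q b = 0 := by rw [← hπ]; exact hx
      have hb := hβ ⟨⟨a, b⟩, hx⟩
      change _ = b at hb
      constructor
      · intro h
        rw [h, map_zero] at hb
        subst hb
        rw [map_zero, add_zero] at hx'
        have := hf (hx'.trans (map_zero f).symm)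
        obtain ⟨l, rfl⟩ := (hip' a).1 this
        exact ⟨l, rfl⟩
      · rintro ⟨l, hl⟩
        have : b = 0 := (congrArg (fun z : LinearMap.ker π => z.1.2) hl).symm
        subst this
        exact hi'' (hb.trans (map_zero _).symm)
    · intro l
      obtain ⟨m', hm'⟩ := (hfg (q (i'' l))).1 (by rw [hq, hip''.apply_apply_eq_zero])
      obtain ⟨a, rfl⟩ := hp' m'
      refine ⟨⟨(-a, i'' l), ?_⟩, ?_⟩
      · rw [LinearMap.mem_ker, hπ, map_neg, map_neg, hm', neg_add_cancel]
      · apply hi''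
        rw [hβ]
        rfl

/-- comparison of kernels -/
lemma ses_ker {L X M' M M'' : Type} [AddCommGroup L] [Module R L] [AddCommGroup X] [Module R X]
    [AddCommGroup M'] [Module R M'] [AddCommGroup M] [Module R M]
    [AddCommGroup M''] [Module R M''] (f : M' →ₗ[R] M) (g : M →ₗ[R] M'')
    (hf : Function.Injective f) (hfg : Function.Exact f g)
    (i : L →ₗ[R] X) (p : X →ₗ[R] M) (hi : Function.Injective i)
    (hip : Function.Exact i p) (hp : Function.Surjective p) :
    ∃ (a : L →ₗ[R] LinearMap.ker (g.comp p)) (b : LinearMap.ker (g.comp p) →ₗ[R] M'),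
      Function.Injective a ∧ Function.Exact a b ∧ Function.Surjective b := by
  obtain ⟨b, hb⟩ := factor_inj f g hf hfg (p.comp (LinearMap.ker (g.comp p)).subtype)
    (fun x => x.2)
  refine ⟨i.codRestrict _ (fun l => by simp [hip.apply_apply_eq_zero]), b, ?_, ?_, ?_⟩
  · intro x y hxy
    exact hi (congrArg Subtype.val hxy)
  · rintro ⟨x, hx⟩
    have hbx : f (b ⟨x, hx⟩) = p x := hb ⟨x, hx⟩
    constructor
    · intro h
      rw [h, map_zero] at hbx
      obtain ⟨l, rfl⟩ := (hip x).1 hbx.symm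
      exact ⟨l, rfl⟩
    · rintro ⟨l, hl⟩
      have : i l = x := congrArg Subtype.val hl
      subst this
      rw [hip.apply_apply_eq_zero] at hbx
      exact hf (hbx.trans (map_zero f).symm)
  · intro m
    obtain ⟨x, hx⟩ := hp (f m)
    refine ⟨⟨x, ?_⟩, ?_⟩
    · rw [LinearMap.mem_ker, LinearMap.comp_apply, hx, hfg.apply_apply_eq_zero]
    · apply hf
      rw [hb]
      exact hx

lemma GG.quot (hC : IsSemidualizing R C) {M' M M'' : Type}
    [AddCommGroup M'] [Module R M'] [AddCommGroup M] [Module R M]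
    [AddCommGroup M''] [Module R M''] (f : M' →ₗ[R] M) (g : M →ₗ[R] M'')
    (hf : Function.Injective f) (hfg : Function.Exact f g)
    (hg : Function.Surjective g) (h' : GG R C M') (h : GG R C M) : GG R C M'' := by
  obtain ⟨L, P, i, p, hP, hi, hip, hp, hL⟩ := h.destruct
  obtain ⟨a, b, ha, hab, hb⟩ := ses_ker f g hf hfg i p hi hip hp
  exact GG.step _ M'' P hP (LinearMap.ker (g.comp p)).subtype (g.comp p)
    (Submodule.injective_subtype _) (LinearMap.exact_subtype_ker_map _) (hg.comp hp)
    (GG.ext hC h' a b ha hab hb hL)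

lemma GG.ker_of_tensor (hC : IsSemidualizing R C) {P M'' : Type}
    [AddCommGroup P] [Module R P] [Module.Projective R P]
    [AddCommGroup M''] [Module R M''] (φ : C ⊗[R] P →ₗ[R] M'')
    (hφ : Function.Surjective φ) (h'' : GG R C M'') : GG R C (LinearMap.ker φ) := by
  obtain ⟨L'', Q, i'', p'', hQ, hi'', hip'', hp'', hL''⟩ := h''.destruct
  obtain ⟨u, hu⟩ := GG.lift hC i'' p'' hi'' hip'' hp'' hL'' φ
  obtain ⟨L1, T, j, t, hT, hj, hjt, ht, hL1⟩ := hL''.destruct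
  let h : (C ⊗[R] P) × (C ⊗[R] T) →ₗ[R] C ⊗[R] Q := u.coprod (i''.comp t)
  have hh : ∀ a b, h (a, b) = u a + i'' (t b) := fun a b => by simp [h]
  have hs : Function.Surjective h := by
    intro y
    obtain ⟨x, hx⟩ := hφ (p'' y)
    obtain ⟨l, hl⟩ := (hip'' (y - u x)).1 (by rw [map_sub, hu, hx, sub_self])
    obtain ⟨b, rfl⟩ := ht l
    exact ⟨(x, b), by rw [hh, hl, add_sub_cancel]⟩
  have hker : ∀ x : LinearMap.ker h, u x.1.1 + i'' (t x.1.2) = 0 := by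
    rintro ⟨⟨a, b⟩, hx⟩
    rw [← hh]; exact hx
  have hN := GG.ker_tensor_prod hC h hs
  refine GG.quot hC
    (((LinearMap.inr R (C ⊗[R] P) (C ⊗[R] T)).comp j).codRestrict (LinearMap.ker h) (fun l => by
      simp [hh, hjt.apply_apply_eq_zero]))
    (((LinearMap.fst R (C ⊗[R] P) (C ⊗[R] T)).comp (LinearMap.ker h).subtype).codRestrict
      (LinearMap.ker φ) (fun x => by
        have := congrArg p'' (hker x)
        rw [map_add, hu, hip''.apply_apply_eq_zero, add_zero, map_zero] at this
        exact this)) ?_ ?_ ?_ hL1 hN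
  · intro x y hxy
    exact hj (congrArg (fun z : LinearMap.ker h => z.1.2) hxy)
  · rintro ⟨⟨a, b⟩, hx⟩
    have hx' := hker ⟨⟨a, b⟩, hx⟩
    simp only at hx'
    constructor
    · intro h0
      have ha : a = 0 := congrArg Subtype.val h0
      subst ha
      rw [map_zero, zero_add] at hx'
      obtain ⟨l, rfl⟩ := (hjt b).1 (hi'' (hx'.trans (map_zero _).symm))
      exact ⟨l, rfl⟩
    · rintro ⟨l, hl⟩
      have : a = 0 := (congrArg (fun z : LinearMap.ker h => z.1.1) hl).symm
      subst this
      rfl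
  · rintro ⟨x, hx⟩
    have hx' : φ x = 0 := hx
    obtain ⟨l, hl⟩ := (hip'' (u x)).1 (by rw [hu, hx'])
    obtain ⟨b, rfl⟩ := ht l
    refine ⟨⟨(x, -b), ?_⟩, rfl⟩
    rw [LinearMap.mem_ker, hh, map_neg, map_neg, hl, add_neg_cancel]

lemma GG.sub (hC : IsSemidualizing R C) {M' M M'' : Type}
    [AddCommGroup M'] [Module R M'] [AddCommGroup M] [Module R M]
    [AddCommGroup M''] [Module R M''] (f : M' →ₗ[R] M) (g : M →ₗ[R] M'')
    (hf : Function.Injective f) (hfg : Function.Exact f g)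
    (hg : Function.Surjective g) (h : GG R C M) (h'' : GG R C M'') : GG R C M' := by
  obtain ⟨L, P, i, p, hP, hi, hip, hp, hL⟩ := h.destruct
  obtain ⟨a, b, ha, hab, hb⟩ := ses_ker f g hf hfg i p hi hip hp
  exact GG.quot hC a b ha hab hb hL (GG.ker_of_tensor hC (g.comp p) (hg.comp hp) h'')

def consP (P : Type) [AddCommGroup P] [Module R P] (Ps : ℕ → ModuleCat.{0} R) :
    ℕ → ModuleCat.{0} R
  | 0 => ModuleCat.of R P
  | k + 1 => Ps k

def consD (P : Type) [AddCommGroup P] [Module R P] (Ps : ℕ → ModuleCat.{0} R)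
    (ds : ∀ i : ℕ, (C ⊗[R] ↥(Ps (i + 1))) →ₗ[R] (C ⊗[R] ↥(Ps i)))
    (e : C ⊗[R] ↥(Ps 0) →ₗ[R] C ⊗[R] P) :
    ∀ k, (C ⊗[R] ↥(consP P Ps (k + 1))) →ₗ[R] (C ⊗[R] ↥(consP P Ps k))
  | 0 => e
  | k + 1 => ds k

lemma GG.hasFinCPd {M : Type} [AddCommGroup M] [Module R M] (h : GG R C M) :
    HasFinCPd R C M := by
  induction h with
  | zero M h =>
    have hs : Subsingleton (C ⊗[R] PUnit.{1}) := inferInstance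
    refine ⟨0, fun _ => ModuleCat.of R PUnit, fun _ => 0, 0, fun _ => inferInstance,
      ⟨fun x => ⟨0, Subsingleton.elim _ _⟩, fun x => ⟨fun _ => ⟨0, hs.elim _ _⟩, fun _ => rfl⟩,
        fun _ x => ⟨fun _ => ⟨0, hs.elim _ _⟩, fun _ => rfl⟩⟩, fun _ _ => hs⟩
  | step L M P hP i p hi hip hp hL ih =>
    obtain ⟨n, P', d', ε', hP', ⟨hε, h0, hd⟩, hb⟩ := ih
    have e0 : Function.Exact (i.comp ε') p := by
      intro x
      rw [hip x]
      constructor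
      · rintro ⟨l, rfl⟩
        obtain ⟨y, rfl⟩ := hε l
        exact ⟨y, rfl⟩
      · rintro ⟨y, rfl⟩
        exact ⟨ε' y, rfl⟩
    have e1 : Function.Exact (d' 0) (i.comp ε') := by
      intro x
      rw [← h0 x, LinearMap.comp_apply, map_eq_zero_iff i hi]
    refine ⟨n + 1, consP P P', consD P P' d' (i.comp ε'), p, ?_, ⟨hp, e0, ?_⟩, ?_⟩
    · rintro (_ | k)
      · exact hP
      · exact hP' k
    · rintro (_ | k)
      · exact e1
      · exact hd k
    · rintro (_ | k) hk
      · omega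
      · exact hb k (by omega)

lemma GG.of_res (n : ℕ) : ∀ (M : Type) [AddCommGroup M] [Module R M] (P : ℕ → ModuleCat.{0} R)
    (d : ∀ i : ℕ, (C ⊗[R] ↥(P (i + 1))) →ₗ[R] (C ⊗[R] ↥(P i)))
    (ε : (C ⊗[R] ↥(P 0)) →ₗ[R] M),
      (∀ i, Module.Projective R ↥(P i)) → ResExact R C M P d ε →
      (∀ i, n ≤ i → Subsingleton (C ⊗[R] ↥(P i))) → GG R C M := by
  induction n with
  | zero =>
    intro M _ _ P d ε hP hr hb
    have := hb 0 le_rfl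
    exact GG.zero M hr.1.subsingleton
  | succ n ih =>
    intro M _ _ P d ε hP hr hb
    obtain ⟨hε, h0, hd⟩ := hr
    refine GG.step (LinearMap.ker ε) M (P 0) (hP 0) (LinearMap.ker ε).subtype ε
      (Submodule.injective_subtype _) (LinearMap.exact_subtype_ker_map _) hε ?_
    refine ih _ (fun k => P (k + 1)) (fun k => d (k + 1))
      ((d 0).codRestrict _ (fun x => h0.apply_apply_eq_zero x)) (fun k => hP _) ⟨?_, ?_, ?_⟩
      (fun k hk => hb _ (by omega))
    · rintro ⟨x, hx⟩
      obtain ⟨y, rfl⟩ := (h0 x).1 hx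
      exact ⟨y, rfl⟩
    · intro x
      rw [← hd 0 x]
      exact Subtype.ext_iff
    · exact fun k => hd (k + 1)

lemma GG_iff {M : Type} [AddCommGroup M] [Module R M] : HasFinCPd R C M ↔ GG R C M := by
  constructor
  · rintro ⟨n, P, d, ε, hP, hr, hb⟩
    exact GG.of_res (n + 1) M P d ε hP hr (fun k hk => hb k (by omega))
  · exact GG.hasFinCPd

end Cls

/-- Two-of-three for finite `P_C`-projective dimension along a short exact sequence
`0 → M' → M → M'' → 0`. -/
theorem finCPd_two_of_three
    (R : Type) [CommRing R] (C : Type) [AddCommGroup C] [Module R C]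
    (M' M M'' : Type) [AddCommGroup M'] [Module R M'] [AddCommGroup M] [Module R M]
    [AddCommGroup M''] [Module R M''] (hC : IsSemidualizing R C)
    (f : M' →ₗ[R] M) (g : M →ₗ[R] M'')
    (hf : Function.Injective f) (hfg : Function.Exact f g)
    (hg : Function.Surjective g) :
    ((HasFinCPd R C M' ∧ HasFinCPd R C M) → HasFinCPd R C M'') ∧
    ((HasFinCPd R C M' ∧ HasFinCPd R C M'') → HasFinCPd R C M) ∧
    ((HasFinCPd R C M ∧ HasFinCPd R C M'') → HasFinCPd R C M') := by
  simp only [GG_iff]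
  exact ⟨fun h => GG.quot hC f g hf hfg hg h.1 h.2, fun h => GG.ext hC h.2 f g hf hfg hg h.1,
    fun h => GG.sub hC f g hf hfg hg h.1 h.2⟩

end
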